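/- Let L be the free Lie algebra over a field K of characteristic zero on two generators e and f, and let 𝒲 := L / L_{≥2,≥2} be the quotient Lie algebra of L by the Lie ideal L_{≥2,≥2}. Denote by 𝒲^n the lower central series of 𝒲 with 𝒲^1 = 𝒲. Then the successive graded quotients have K-dimensions: dim_K(𝒲^1/𝒲^2) = 2, dim_K(𝒲^2/𝒲^3) = 1, and dim_K(𝒲^n/𝒲^{n+1}) = 2 for every n ≥ 3. -/

import Mathlib

noncomputable section

namespace CMPaper

variable (K : Type*) [Field K] [CharZero K]

/-- The free Lie algebra on two generators. -/
abbrev L := FreeLieAlgebra K (Fin 2)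

/-- The first generator `e`. -/
def e : L K := FreeLieAlgebra.of K (0 : Fin 2)

/-- The second generator `f`. -/
def f : L K := FreeLieAlgebra.of K (1 : Fin 2)

/-- Iterated Lie bracket monomials in the generators in which `e` occurs exactly `i`
times and `f` occurs exactly `j` times. -/
inductive IsLieMonomial : L K → ℕ → ℕ → Prop
  | gen_e : IsLieMonomial (e K) 1 0
  | gen_f : IsLieMonomial (f K) 0 1
  | brak {x y : L K} {i j k l : ℕ} :
      IsLieMonomial x i j → IsLieMonomial y k l → IsLieMonomial ⁅x, y⁆ (i + k) (j + l)

/-- The bigraded component `L_{i,j}`: the `K`-span of the Lie monomials of bidegree `(i,j)`. -/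
def bihom (i j : ℕ) : Submodule K (L K) :=
  Submodule.span K {x : L K | IsLieMonomial K x i j}

/-- `L_{≥n,≥m}`: the submodule generated by all `L_{i,j}` with `i ≥ n`, `j ≥ m`. -/
def bihomGE (n m : ℕ) : Submodule K (L K) :=
  ⨆ (i : ℕ) (j : ℕ) (_ : n ≤ i) (_ : m ≤ j), bihom K i j

/-- The lower central series, normalized so that `lcs 1 = L` and `lcs (n+1) = ⁅L, lcs n⁆`. -/
def lcs (n : ℕ) : LieIdeal K (L K) := LieModule.lowerCentralSeries K (L K) (L K) (n - 1)

variable {K} in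
/-- The `K`-dimension of the `n`-th graded piece `𝒲^n / 𝒲^{n+1}` of the lower central
series (normalized with `𝒲^1 = 𝒲`) of the quotient Lie algebra `𝒲 = L / I`, realized as
the image of `𝒲^n` in `𝒲 / 𝒲^{n+1}`. -/
noncomputable def gradedPieceDim (I : LieIdeal K (L K)) (n : ℕ) : ℕ :=
  Module.finrank K
    ↥((LieModule.lowerCentralSeries K (L K ⧸ I) (L K ⧸ I) (n - 1) :
        Submodule K (L K ⧸ I)).map
      (LieModule.lowerCentralSeries K (L K ⧸ I) (L K ⧸ I) n :
        Submodule K (L K ⧸ I)).mkQ)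

section Helpers

attribute [local instance] LieRing.ofAssociativeRing

open Polynomial

variable {K} in
theorem finrank_two {W : Type*} [AddCommGroup W] [Module K W] (N N' : Submodule K W) (u v : W)
    (hu : u ∈ N) (hv : v ∈ N) (hN : N ≤ Submodule.span K {u, v} ⊔ N')
    (φ ψ : W →ₗ[K] K) (hφ : ∀ x ∈ N', φ x = 0) (hψ : ∀ x ∈ N', ψ x = 0)
    (h1 : φ u ≠ 0) (h2 : ψ u = 0) (h3 : φ v = 0) (h4 : ψ v ≠ 0) :
    Module.finrank K (N.map N'.mkQ) = 2 := by
  have hli : LinearIndependent K ![N'.mkQ u, N'.mkQ v] := by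
    rw [LinearIndependent.pair_iff]
    intro s t h
    rw [← map_smul, ← map_smul, ← map_add, Submodule.mkQ_apply, Submodule.Quotient.mk_eq_zero] at h
    have a := hφ _ h
    have b := hψ _ h
    simp [h2, h3, h1, h4] at a b
    exact ⟨a, b⟩
  have hs : N.map N'.mkQ = Submodule.span K (Set.range ![N'.mkQ u, N'.mkQ v]) := by
    apply le_antisymm
    · refine (Submodule.map_mono hN).trans ?_
      rw [Submodule.map_sup, Submodule.map_span, Submodule.mkQ_map_self, sup_bot_eq,
        Set.image_pair]
      simp [Set.pair_comm]
    · rw [Submodule.span_le]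
      rintro _ ⟨i, rfl⟩
      fin_cases i
      · exact Submodule.mem_map_of_mem hu
      · exact Submodule.mem_map_of_mem hv
  rw [hs, finrank_span_eq_card hli]
  simp

variable {K} in
theorem finrank_one {W : Type*} [AddCommGroup W] [Module K W] (N N' : Submodule K W) (u : W)
    (hu : u ∈ N) (hN : N ≤ Submodule.span K {u} ⊔ N')
    (φ : W →ₗ[K] K) (hφ : ∀ x ∈ N', φ x = 0) (h1 : φ u ≠ 0) :
    Module.finrank K (N.map N'.mkQ) = 1 := by
  have hs : N.map N'.mkQ = Submodule.span K {N'.mkQ u} := by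
    apply le_antisymm
    · refine (Submodule.map_mono hN).trans ?_
      rw [Submodule.map_sup, Submodule.map_span, Submodule.mkQ_map_self, sup_bot_eq,
        Set.image_singleton]
    · rw [Submodule.span_le, Set.singleton_subset_iff]
      exact Submodule.mem_map_of_mem hu
  rw [hs, finrank_span_singleton]
  intro h
  rw [Submodule.mkQ_apply, Submodule.Quotient.mk_eq_zero] at h
  exact h1 (hφ _ h)

variable {K} in
/-- The generators generate. -/
theorem mem_of_gens (S : LieSubalgebra K (L K)) (he : e K ∈ S) (hf : f K ∈ S) (x : L K) :
    x ∈ S := by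
  let g : L K →ₗ⁅K⁆ S := FreeLieAlgebra.lift K ![⟨e K, he⟩, ⟨f K, hf⟩]
  have h : S.incl.comp g = LieHom.id := by
    apply FreeLieAlgebra.hom_ext
    intro i
    fin_cases i <;> simp [g, e, f]
  have := congrArg (fun F : L K →ₗ⁅K⁆ L K => F x) h
  simp at this
  rw [← this]
  exact (g x).2

/-- matrices -/
abbrev Mat := Matrix (Fin 2) (Fin 2) K[X]

variable {K}

theorem bracket_formula (a b p q : K[X]) :
    ⁅(!![a, p; 0, 0] : Mat K), (!![b, q; 0, 0] : Mat K)⁆ = !![0, a * q - b * p; 0, 0] := by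
  rw [LieRing.of_associative_ring_bracket]
  ext i j
  fin_cases i <;> fin_cases j <;> simp [mul_comm]

/-- representation -/
def rho : L K →ₗ⁅K⁆ Mat K := FreeLieAlgebra.lift K ![!![X, 0; 0, 0], !![0, 1; 0, 0]]

theorem rho_e : rho (e K) = !![X, 0; 0, 0] := by simp [rho, e]
theorem rho_f : rho (f K) = !![0, 1; 0, 0] := by simp [rho, f]

/-- swap -/
def swp : L K →ₗ⁅K⁆ L K := FreeLieAlgebra.lift K ![f K, e K]
theorem swp_e : swp (e K) = f K := by simp [swp, e]
theorem swp_f : swp (f K) = e K := by simp [swp, f]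

theorem swp_mono {x : L K} {i j : ℕ} (h : IsLieMonomial K x i j) :
    IsLieMonomial K (swp x) j i := by
  induction h with
  | gen_e => rw [swp_e]; exact .gen_f
  | gen_f => rw [swp_f]; exact .gen_e
  | brak _ _ h1 h2 => rw [LieHom.map_lie]; exact .brak h1 h2

theorem rho_mono {x : L K} {i j : ℕ} (h : IsLieMonomial K x i j) :
    (j = 0 → ∃ a, rho x = !![a, 0; 0, 0]) ∧ (j = 1 → ∃ p, rho x = !![0, p; 0, 0]) ∧
      (2 ≤ j → rho x = !![0, 0; 0, 0]) := by
  induction h with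
  | gen_e => simp [rho_e]
  | gen_f => simp [rho_f]
  | @brak x y i j k l _ _ h1 h2 =>
    have key : ∀ j : ℕ, j = 0 ∨ j = 1 ∨ 2 ≤ j := by omega
    rw [LieHom.map_lie]
    obtain ⟨a1, b1, c1⟩ := h1
    obtain ⟨a2, b2, c2⟩ := h2
    rcases key j with hj | hj | hj <;> rcases key l with hl | hl | hl
    · obtain ⟨a, ha⟩ := a1 hj
      obtain ⟨b, hb⟩ := a2 hl
      rw [ha, hb, bracket_formula]
      refine ⟨fun _ => ⟨0, by simp⟩, by omega, by omega⟩
    · obtain ⟨a, ha⟩ := a1 hj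
      obtain ⟨b, hb⟩ := b2 hl
      rw [ha, hb, bracket_formula]
      refine ⟨by omega, fun _ => ⟨_, rfl⟩, by omega⟩
    · obtain ⟨a, ha⟩ := a1 hj
      rw [ha, c2 hl, bracket_formula]
      refine ⟨by omega, by omega, fun _ => by simp⟩
    · obtain ⟨a, ha⟩ := b1 hj
      obtain ⟨b, hb⟩ := a2 hl
      rw [ha, hb, bracket_formula]
      refine ⟨by omega, fun _ => ⟨_, rfl⟩, by omega⟩
    · obtain ⟨a, ha⟩ := b1 hj
      obtain ⟨b, hb⟩ := b2 hl
      rw [ha, hb, bracket_formula]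
      refine ⟨by omega, by omega, fun _ => by simp⟩
    · obtain ⟨a, ha⟩ := b1 hj
      rw [ha, c2 hl, bracket_formula]
      refine ⟨by omega, by omega, fun _ => by simp⟩
    · obtain ⟨a, ha⟩ := a2 hl
      rw [ha, c1 hj, bracket_formula]
      refine ⟨by omega, by omega, fun _ => by simp⟩
    · obtain ⟨a, ha⟩ := b2 hl
      rw [ha, c1 hj, bracket_formula]
      refine ⟨by omega, by omega, fun _ => by simp⟩
    · rw [c1 hj, c2 hl, bracket_formula]
      refine ⟨by omega, by omega, fun _ => by simp⟩

theorem zeroMat : (!![0, 0; 0, 0] : Mat K) = 0 := by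
  ext i j; fin_cases i <;> fin_cases j <;> simp

theorem bihomGE_le {S : Submodule K (L K)}
    (h : ∀ x i j, 2 ≤ i → 2 ≤ j → IsLieMonomial K x i j → x ∈ S) : bihomGE K 2 2 ≤ S := by
  unfold bihomGE bihom
  refine iSup_le fun i => iSup_le fun j => iSup_le fun hi => iSup_le fun hj => ?_
  rw [Submodule.span_le]
  intro x hx
  exact h x i j hi hj hx

theorem mono_mem_bihomGE {x : L K} {i j : ℕ} (hi : 2 ≤ i) (hj : 2 ≤ j)
    (h : IsLieMonomial K x i j) : x ∈ bihomGE K 2 2 := by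
  have : bihom K i j ≤ bihomGE K 2 2 :=
    le_iSup_of_le i (le_iSup_of_le j (le_iSup_of_le hi (le_iSup_of_le hj le_rfl)))
  exact this (Submodule.subset_span h)

theorem rho_kill {x : L K} (hx : x ∈ bihomGE K 2 2) : rho x = 0 := by
  have : bihomGE K 2 2 ≤ LinearMap.ker (rho : L K →ₗ⁅K⁆ Mat K).toLinearMap :=
    bihomGE_le fun x i j _ hj h => by
      rw [LinearMap.mem_ker]
      exact ((rho_mono h).2.2 hj).trans zeroMat
  exact this hx

theorem rho_swp_kill {x : L K} (hx : x ∈ bihomGE K 2 2) : rho (swp x) = 0 := by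
  have : bihomGE K 2 2 ≤ LinearMap.ker ((rho.comp swp : L K →ₗ⁅K⁆ Mat K)).toLinearMap :=
    bihomGE_le fun x i j hi _ h => by
      rw [LinearMap.mem_ker]
      exact ((rho_mono (swp_mono h)).2.2 hi).trans zeroMat
  exact this hx

theorem rho_shape (x : L K) : ∃ (a : K) (p : K[X]), rho x = !![C a * X, p; 0, 0] := by
  let S : LieSubalgebra K (L K) :=
    { carrier := {x | ∃ (a : K) (p : K[X]), rho x = !![C a * X, p; 0, 0]}
      zero_mem' := ⟨0, 0, by rw [map_zero, ← zeroMat]; simp⟩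
      add_mem' := by
        rintro x y ⟨a, p, h⟩ ⟨b, q, h'⟩
        refine ⟨a + b, p + q, ?_⟩
        rw [map_add, h, h']
        ext i j
        fin_cases i <;> fin_cases j <;> simp [add_mul]
      smul_mem' := by
        rintro c x ⟨a, p, h⟩
        refine ⟨c * a, c • p, ?_⟩
        rw [map_smul, h]
        ext i j
        fin_cases i <;> fin_cases j <;> simp [smul_eq_C_mul, mul_assoc]
      lie_mem' := by
        rintro x y ⟨a, p, h⟩ ⟨b, q, h'⟩
        refine ⟨0, C a * X * q - C b * X * p, ?_⟩
        rw [LieHom.map_lie, h, h', bracket_formula]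
        simp }
  exact mem_of_gens S ⟨1, 0, by simp [rho_e]⟩ ⟨0, 1, by simp [rho_f]⟩ x

/-- iterated brackets `ad(e)^k f`. -/
def uL : ℕ → L K
  | 0 => f K
  | k + 1 => ⁅e K, uL k⁆

/-- iterated brackets `ad(f)^k e`. -/
def vL : ℕ → L K
  | 0 => e K
  | k + 1 => ⁅f K, vL k⁆

theorem swp_u (k : ℕ) : swp (uL k : L K) = vL k := by
  induction k with
  | zero => exact swp_f
  | succ k ih => rw [uL, vL, LieHom.map_lie, ih, swp_e]

theorem swp_v (k : ℕ) : swp (vL k : L K) = uL k := by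
  induction k with
  | zero => exact swp_e
  | succ k ih => rw [uL, vL, LieHom.map_lie, ih, swp_f]

theorem mono_u (k : ℕ) : IsLieMonomial K (uL k) k 1 := by
  induction k with
  | zero => exact .gen_f
  | succ k ih => simpa [uL, add_comm] using IsLieMonomial.brak .gen_e ih

theorem mono_v (k : ℕ) : IsLieMonomial K (vL k) 1 k := by
  induction k with
  | zero => exact .gen_e
  | succ k ih => simpa [vL, add_comm] using IsLieMonomial.brak .gen_f ih

theorem rho_u (k : ℕ) : rho (uL k : L K) = !![0, X ^ k; 0, 0] := by
  induction k with
  | zero => simp [uL, rho_f]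
  | succ k ih => rw [uL, LieHom.map_lie, ih, rho_e, bracket_formula, pow_succ']; simp

theorem rho_v_one : rho (vL 1 : L K) = !![0, -X; 0, 0] := by
  rw [vL, vL, LieHom.map_lie, rho_e, rho_f, bracket_formula]; simp

theorem rho_v (k : ℕ) (hk : k ≠ 1) : rho (vL k : L K) 0 1 = 0 := by
  rcases k with _ | _ | k
  · simp [vL, rho_e]
  · exact absurd rfl hk
  · rw [(rho_mono (mono_v (k + 2))).2.2 (by omega)]; simp

section Quot

variable (I : LieIdeal K (L K))

/-- the terms of the lower central series, as submodules -/
abbrev N (k : ℕ) : Submodule K (L K ⧸ I) :=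
  (LieModule.lowerCentralSeries K (L K ⧸ I) (L K ⧸ I) k : Submodule K (L K ⧸ I))

/-- quotient map -/
abbrev mkI (x : L K) : L K ⧸ I := LieSubmodule.Quotient.mk (N := I) x

theorem N_succ (k : ℕ) :
    N I (k + 1) = Submodule.span K {m | ∃ x : L K ⧸ I, ∃ y ∈ N I k, ⁅x, y⁆ = m} := by
  rw [N, LieModule.lowerCentralSeries_succ]
  refine (LieSubmodule.lieIdeal_oper_eq_linear_span' _ _).trans ?_
  simp

theorem lie_mem_N {k : ℕ} (x : L K ⧸ I) {y : L K ⧸ I} (hy : y ∈ N I k) :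
    ⁅x, y⁆ ∈ N I (k + 1) := by
  rw [N_succ]
  exact Submodule.subset_span ⟨x, y, hy, rfl⟩

theorem u_mem (k : ℕ) : mkI I (uL k) ∈ N I k := by
  induction k with
  | zero => simp [N]
  | succ k ih => exact lie_mem_N I (mkI I (e K)) ih

theorem v_mem (k : ℕ) : mkI I (vL k) ∈ N I k := by
  induction k with
  | zero => simp [N]
  | succ k ih => exact lie_mem_N I (mkI I (f K)) ih

/-- span of the two standard monomials -/
abbrev SP (k : ℕ) : Submodule K (L K ⧸ I) :=
  Submodule.span K {mkI I (uL k), mkI I (vL k)}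

theorem u_SP (k : ℕ) : mkI I (uL k) ∈ SP I k := Submodule.subset_span (by simp)
theorem v_SP (k : ℕ) : mkI I (vL k) ∈ SP I k := Submodule.subset_span (by simp)

theorem fu_mem (hI : (I : Submodule K (L K)) = bihomGE K 2 2) (k : ℕ) :
    mkI I ⁅f K, uL k⁆ ∈ SP I (k + 1) := by
  rcases k with _ | _ | k
  · simp [uL, mkI]
  · have : ⁅f K, (uL 1 : L K)⁆ = -vL 2 := by
      simp only [uL, vL]
      rw [← lie_skew (f K) (e K), lie_neg, neg_neg]
    rw [this]
    exact neg_mem (v_SP I 2)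
  · have h : ⁅f K, uL (k + 2)⁆ ∈ I := by
      refine (SetLike.ext_iff.1 hI _).2 ?_
      exact mono_mem_bihomGE (i := 0 + (k + 2)) (by omega) (by omega)
        (.brak .gen_f (mono_u (k + 2)))
    rw [mkI, (LieSubmodule.Quotient.mk_eq_zero' (N := I)).2 h]
    exact zero_mem _

theorem ev_mem (hI : (I : Submodule K (L K)) = bihomGE K 2 2) (k : ℕ) :
    mkI I ⁅e K, vL k⁆ ∈ SP I (k + 1) := by
  rcases k with _ | _ | k
  · simp [vL, mkI]
  · have : ⁅e K, (vL 1 : L K)⁆ = -uL 2 := by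
      simp only [uL, vL]
      rw [← lie_skew (e K) (f K), lie_neg, neg_neg]
    rw [this]
    exact neg_mem (u_SP I 2)
  · have h : ⁅e K, vL (k + 2)⁆ ∈ I := by
      refine (SetLike.ext_iff.1 hI _).2 ?_
      exact mono_mem_bihomGE (j := 0 + (k + 2)) (by omega) (by omega)
        (.brak .gen_e (mono_v (k + 2)))
    rw [mkI, (LieSubmodule.Quotient.mk_eq_zero' (N := I)).2 h]
    exact zero_mem _

theorem gen_step {k : ℕ} (hk : N I k ≤ SP I k ⊔ N I (k + 1)) (g : L K)
    (h1 : mkI I ⁅g, uL k⁆ ∈ SP I (k + 1)) (h2 : mkI I ⁅g, vL k⁆ ∈ SP I (k + 1)) :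
    ∀ y ∈ N I k, ⁅mkI I g, y⁆ ∈ SP I (k + 1) ⊔ N I (k + 2) := by
  intro y hy
  obtain ⟨s, hs, t, ht, rfl⟩ := Submodule.mem_sup.1 (hk hy)
  obtain ⟨a, b, rfl⟩ := Submodule.mem_span_pair.1 hs
  rw [lie_add, lie_add, lie_smul, lie_smul]
  refine add_mem (Submodule.mem_sup_left (add_mem ?_ ?_)) (Submodule.mem_sup_right ?_)
  · exact Submodule.smul_mem _ _ h1
  · exact Submodule.smul_mem _ _ h2
  · exact lie_mem_N I _ ht

theorem N_le (hI : (I : Submodule K (L K)) = bihomGE K 2 2) (k : ℕ) :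
    N I k ≤ SP I k ⊔ N I (k + 1) := by
  induction k with
  | zero =>
    let S : LieSubalgebra K (L K) :=
      { carrier := {x | mkI I x ∈ SP I 0 ⊔ N I 1}
        zero_mem' := zero_mem (SP I 0 ⊔ N I 1)
        add_mem' := fun {x y} hx hy => Submodule.add_mem (SP I 0 ⊔ N I 1) hx hy
        smul_mem' := fun c x hx => Submodule.smul_mem (SP I 0 ⊔ N I 1) c hx
        lie_mem' := fun {x y} _ _ =>
          Submodule.mem_sup_right (lie_mem_N I (k := 0) (mkI I x) (y := mkI I y) (by simp [N])) }
    intro w _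
    obtain ⟨x, rfl⟩ := LieSubmodule.Quotient.surjective_mk' I w
    exact mem_of_gens S (Submodule.mem_sup_left (v_SP I 0)) (Submodule.mem_sup_left (u_SP I 0)) x
  | succ k ih =>
    rw [N_succ I k, Submodule.span_le]
    rintro _ ⟨w, y, hy, rfl⟩
    obtain ⟨x, rfl⟩ := LieSubmodule.Quotient.surjective_mk' I w
    let S : LieSubalgebra K (L K) :=
      { carrier := {x | ∀ y ∈ N I k, ⁅mkI I x, y⁆ ∈ SP I (k + 1) ⊔ N I (k + 2)}
        zero_mem' := fun y _ => by
          have : mkI I (0 : L K) = 0 := rfl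
          rw [this, zero_lie]; exact zero_mem _
        add_mem' := fun {a b} ha hb y hy => by
          have : mkI I (a + b) = mkI I a + mkI I b := rfl
          rw [this, add_lie]; exact add_mem (ha y hy) (hb y hy)
        smul_mem' := fun c a ha y hy => by
          have : mkI I (c • a) = c • mkI I a := rfl
          rw [this, smul_lie]; exact Submodule.smul_mem _ c (ha y hy)
        lie_mem' := fun {a b} _ _ y hy => by
          have : mkI I ⁅a, b⁆ = ⁅mkI I a, mkI I b⁆ := rfl
          rw [this, lie_lie]
          exact Submodule.mem_sup_right
            (sub_mem (lie_mem_N I _ (lie_mem_N I _ hy)) (lie_mem_N I _ (lie_mem_N I _ hy))) }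
    exact mem_of_gens S
      (gen_step I ih (e K) (u_SP I (k + 1)) (ev_mem I hI k))
      (gen_step I ih (f K) (fu_mem I hI k) (v_SP I (k + 1))) x y hy

/-- A lift of a Lie hom to the quotient, as a linear map. -/
def tau (r : L K →ₗ⁅K⁆ Mat K) (h : ∀ x ∈ I, r x = 0) : (L K ⧸ I) →ₗ[K] Mat K :=
  (I : Submodule K (L K)).liftQ r.toLinearMap h

theorem tau_mk (r : L K →ₗ⁅K⁆ Mat K) (h : ∀ x ∈ I, r x = 0) (x : L K) :
    tau I r h (mkI I x) = r x := rfl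

theorem tau_N (r : L K →ₗ⁅K⁆ Mat K) (h : ∀ x ∈ I, r x = 0)
    (hr : ∀ x, ∃ (a : K) (p : K[X]), r x = !![C a * X, p; 0, 0]) (k : ℕ) :
    ∀ w ∈ N I (k + 1), ∃ p : K[X], tau I r h w = !![0, X ^ (k + 1) * p; 0, 0] := by
  have hadd : ∀ n : ℕ, ∀ x y : L K ⧸ I, (∃ p : K[X], tau I r h x = !![0, X ^ n * p; 0, 0]) →
      (∃ p : K[X], tau I r h y = !![0, X ^ n * p; 0, 0]) →
      ∃ p : K[X], tau I r h (x + y) = !![0, X ^ n * p; 0, 0] := by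
    rintro n x y ⟨p, hp⟩ ⟨q, hq⟩
    refine ⟨p + q, ?_⟩
    rw [map_add, hp, hq]
    ext i j
    fin_cases i <;> fin_cases j <;> simp [mul_add]
  have smul : ∀ n : ℕ, ∀ (c : K) (x : L K ⧸ I),
      (∃ p : K[X], tau I r h x = !![0, X ^ n * p; 0, 0]) →
      ∃ p : K[X], tau I r h (c • x) = !![0, X ^ n * p; 0, 0] := by
    rintro n c x ⟨p, hp⟩
    refine ⟨c • p, ?_⟩
    rw [map_smul, hp]
    ext i j
    fin_cases i <;> fin_cases j <;> simp
  have lie : ∀ x y : L K ⧸ I, tau I r h ⁅x, y⁆ = ⁅tau I r h x, tau I r h y⁆ := by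
    intro x y
    obtain ⟨x, rfl⟩ := LieSubmodule.Quotient.surjective_mk' I x
    obtain ⟨y, rfl⟩ := LieSubmodule.Quotient.surjective_mk' I y
    exact LieHom.map_lie r x y
  have shape : ∀ x : L K ⧸ I, ∃ (a : K) (p : K[X]), tau I r h x = !![C a * X, p; 0, 0] := by
    intro x
    obtain ⟨x, rfl⟩ := LieSubmodule.Quotient.surjective_mk' I x
    exact hr x
  induction k with
  | zero =>
    intro w hw
    rw [N_succ] at hw
    induction hw using Submodule.span_induction with
    | mem w hw =>
      obtain ⟨x, y, -, rfl⟩ := hw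
      obtain ⟨a, p, hx⟩ := shape x
      obtain ⟨b, q, hy⟩ := shape y
      refine ⟨C a * q - C b * p, ?_⟩
      rw [lie, hx, hy, bracket_formula]
      congr 4
      ring
    | zero => exact ⟨0, by rw [map_zero, ← zeroMat]; simp⟩
    | add x y _ _ hx hy => exact hadd _ x y hx hy
    | smul c x _ hx => exact smul _ c x hx
  | succ k ih =>
    intro w hw
    rw [N_succ] at hw
    induction hw using Submodule.span_induction with
    | mem w hw =>
      obtain ⟨x, y, hy, rfl⟩ := hw
      obtain ⟨a, p, hx⟩ := shape x
      obtain ⟨q, hy⟩ := ih y hy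
      refine ⟨C a * q, ?_⟩
      rw [lie, hx, hy, bracket_formula]
      congr 4
      ring
    | zero => exact ⟨0, by rw [map_zero, ← zeroMat]; simp⟩
    | add x y _ _ hx hy => exact hadd _ x y hx hy
    | smul c x _ hx => exact smul _ c x hx

/-- coefficient functional -/
def phi (r : L K →ₗ⁅K⁆ Mat K) (h : ∀ x ∈ I, r x = 0) (k : ℕ) : (L K ⧸ I) →ₗ[K] K :=
  (lcoeff K k).comp ((Matrix.entryLinearMap K K[X] (0 : Fin 2) (1 : Fin 2)).comp (tau I r h))

theorem phi_mk (r : L K →ₗ⁅K⁆ Mat K) (h : ∀ x ∈ I, r x = 0) (k : ℕ) (x : L K) :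
    phi I r h k (mkI I x) = (r x 0 1).coeff k := rfl

theorem phi_N (r : L K →ₗ⁅K⁆ Mat K) (h : ∀ x ∈ I, r x = 0)
    (hr : ∀ x, ∃ (a : K) (p : K[X]), r x = !![C a * X, p; 0, 0]) (k : ℕ) :
    ∀ w ∈ N I (k + 1), phi I r h k w = 0 := by
  intro w hw
  obtain ⟨p, hp⟩ := tau_N I r h hr k w hw
  have : phi I r h k w = (tau I r h w 0 1).coeff k := rfl
  rw [this, hp]
  simp [coeff_X_pow_mul']

theorem dim_two (hI : (I : Submodule K (L K)) = bihomGE K 2 2) (k : ℕ) (hk : k ≠ 1) :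
    Module.finrank K ((N I k).map (N I (k + 1)).mkQ) = 2 := by
  have h1 : ∀ x ∈ I, rho x = 0 := fun x hx => rho_kill (by rwa [← hI])
  have h2 : ∀ x ∈ I, (rho.comp swp : L K →ₗ⁅K⁆ Mat K) x = 0 :=
    fun x hx => rho_swp_kill (by rwa [← hI])
  refine finrank_two _ _ _ _ (u_mem I k) (v_mem I k) (N_le I hI k) (phi I rho h1 k)
    (phi I (rho.comp swp) h2 k) (phi_N I _ _ rho_shape k)
    (phi_N I _ _ (fun x => rho_shape (swp x)) k) ?_ ?_ ?_ ?_
  · simp [phi_mk, rho_u]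
  · rw [phi_mk, LieHom.comp_apply, swp_u, rho_v k hk, coeff_zero]
  · rw [phi_mk, rho_v k hk, coeff_zero]
  · simp [phi_mk, rho_u, swp_v]

theorem dim_one (hI : (I : Submodule K (L K)) = bihomGE K 2 2) :
    Module.finrank K ((N I 1).map (N I 2).mkQ) = 1 := by
  have h1 : ∀ x ∈ I, rho x = 0 := fun x hx => rho_kill (by rwa [← hI])
  refine finrank_one _ _ _ (u_mem I 1) ((N_le I hI 1).trans (sup_le_sup_right ?_ _))
    (phi I rho h1 1) (phi_N I _ _ rho_shape 1) ?_
  · rw [Submodule.span_le]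
    rintro x (rfl | rfl)
    · exact Submodule.mem_span_singleton_self _
    · have : vL 1 = -(uL 1 : L K) := by simp only [uL, vL]; rw [lie_skew]
      rw [this]
      exact neg_mem (S := Submodule K (L K ⧸ I)) (Submodule.mem_span_singleton_self _)
  · simp [phi_mk, rho_u]

end Quot

end Helpers

/-- For the quotient Lie algebra `𝒲 = L / L_{≥2,≥2}`, the successive graded quotients of
the lower central series satisfy `dim 𝒲¹/𝒲² = 2`, `dim 𝒲²/𝒲³ = 1`, and
`dim 𝒲ⁿ/𝒲ⁿ⁺¹ = 2` for `n ≥ 3`. -/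
theorem quotient_graded_dims (I : LieIdeal K (L K))
    (hI : (I : Submodule K (L K)) = bihomGE K 2 2) :
    gradedPieceDim I 1 = 2 ∧ gradedPieceDim I 2 = 1 ∧
      ∀ n : ℕ, 3 ≤ n → gradedPieceDim I n = 2 := by
  refine ⟨dim_two I hI 0 (by omega), dim_one I hI, fun n hn => ?_⟩
  obtain ⟨k, rfl⟩ : ∃ k, n = k + 1 := ⟨n - 1, by omega⟩
  exact dim_two I hI k (by omega)

end CMPaper
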